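/- arXiv:2505.02149 — 14 statements merged into one kernel-verified Lean document; each statement's English description precedes it below -/
import Mathlib

section
/- The bilateral adding machine map f_α : Δ → Δ is injective. -/
/-- The bilateral adding machine space `Δ`: a point `(u, v)` is a bisequence with
negative coordinates `x_{-(n+1)} := u n ∈ ZMod 2` and nonnegative coordinates
`x_n := v n ∈ ZMod j` (identifying `Fin 2` with `ZMod 2` and `Fin j` with `ZMod j`). -/
abbrev AddingMachineSpace (j : ℕ) : Type := (ℕ → ZMod 2) × (ℕ → ZMod j)

/-- The carries on the nonnegative side: `c 0 = 1` and `c (n+1) = 1` if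
`(v n).val + (c n).val ≥ j`, and `0` otherwise. -/
def carryPos (j : ℕ) (v : ℕ → ZMod j) : ℕ → ZMod j
  | 0 => 1
  | n + 1 => if j ≤ (v n).val + (carryPos j v n).val then 1 else 0

/-- The carries on the negative side: `s 0 = τ (v 0 + 1)` and `s (n+1) = 1` if
`(u n).val + (s n).val ≥ 2`, and `0` otherwise. -/
def carryNeg (j : ℕ) (τ : ZMod j → ZMod 2) (u : ℕ → ZMod 2) (v : ℕ → ZMod j) :
    ℕ → ZMod 2
  | 0 => τ (v 0 + 1)
  | n + 1 => if 2 ≤ (u n).val + (carryNeg j τ u v n).val then 1 else 0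

/-- The bilateral adding machine map `f_α : Δ → Δ`. -/
def addingMachine (j : ℕ) (τ : ZMod j → ZMod 2) (x : AddingMachineSpace j) :
    AddingMachineSpace j :=
  (fun n => x.1 n + carryNeg j τ x.1 x.2 n, fun n => x.2 n + carryPos j x.2 n)

/-- The bilateral adding machine map `f_α : Δ → Δ` is injective. -/
theorem addingMachine_injective (j : ℕ) (hj : 2 ≤ j) (τ : ZMod j → ZMod 2)
    (hτ : Function.Surjective τ) :
    Function.Injective (addingMachine j τ) := by
  rintro ⟨u, v⟩ ⟨u', v'⟩ h
  simp only [addingMachine, Prod.mk.injEq] at h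
  obtain ⟨h1, h2⟩ := h
  have hv : ∀ n, carryPos j v n = carryPos j v' n := by
    intro n
    induction n with
    | zero => simp only [carryPos]
    | succ n ih =>
      have e := congrFun h2 n
      simp only [ih] at e
      have e' := add_right_cancel e
      simp only [carryPos, ih, e']
  have hvv : v = v' := by
    funext n
    have e := congrFun h2 n
    simp only [hv n] at e
    exact add_right_cancel e
  subst hvv
  have hu : ∀ n, carryNeg j τ u v n = carryNeg j τ u' v n := by
    intro n
    induction n with
    | zero => simp only [carryNeg]
    | succ n ih =>
      have e := congrFun h1 n
      simp only [ih] at e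
      have e' := add_right_cancel e
      simp only [carryNeg, ih, e']
  have huu : u = u' := by
    funext n
    have e := congrFun h1 n
    simp only [hu n] at e
    exact add_right_cancel e
  rw [huu]
end

section
/- The bilateral adding machine map f_α : Δ → Δ is surjective. -/
/-- Carries recovered from the target sequence. -/
def backCarry (m : ℕ) (init : ZMod m) (b : ℕ → ZMod m) : ℕ → ZMod m
  | 0 => init
  | n + 1 => if m ≤ (b n - backCarry m init b n).val + (backCarry m init b n).val then 1 else 0

/-- The bilateral adding machine map `f_α : Δ → Δ` is surjective. -/
theorem addingMachine_surjective (j : ℕ) (hj : 2 ≤ j) (τ : ZMod j → ZMod 2)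
    (hτ : Function.Surjective τ) :
    Function.Surjective (addingMachine j τ) := by
  rintro ⟨a, b⟩
  have hv : ∀ n, carryPos j (fun n => b n - backCarry j 1 b n) n = backCarry j 1 b n := by
    intro n
    induction n with
    | zero => rfl
    | succ k ih => simp only [carryPos, backCarry, ih]
  have hu : ∀ n, carryNeg j τ (fun n => a n - backCarry 2 (τ (b 0)) a n)
      (fun n => b n - backCarry j 1 b n) n = backCarry 2 (τ (b 0)) a n := by
    intro n
    induction n with
    | zero => simp [carryNeg, backCarry]
    | succ k ih => simp only [carryNeg, backCarry, ih]
  refine ⟨(fun n => a n - backCarry 2 (τ (b 0)) a n, fun n => b n - backCarry j 1 b n), ?_⟩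
  refine Prod.ext (funext fun n => ?_) (funext fun n => ?_)
  · simp only [addingMachine, hu, sub_add_cancel]
  · simp only [addingMachine, hv, sub_add_cancel]
end

section
/- The bilateral adding machine map f_α : Δ → Δ is continuous. -/
theorem continuous_op_aux {X A B C : Type*} [TopologicalSpace X] [TopologicalSpace A]
    [DiscreteTopology A] [TopologicalSpace B] [DiscreteTopology B] [TopologicalSpace C]
    (g : A → B → C) {a : X → A} {b : X → B} (ha : Continuous a) (hb : Continuous b) :
    Continuous fun x => g (a x) (b x) :=
  (continuous_of_discreteTopology (f := fun p : A × B => g p.1 p.2)).comp (ha.prodMk hb)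

theorem continuous_carryPos (j : ℕ) (n : ℕ) :
    Continuous fun x : AddingMachineSpace j => carryPos j x.2 n := by
  induction n with
  | zero => exact continuous_const
  | succ n ih =>
    exact continuous_op_aux (fun a b : ZMod j => if j ≤ a.val + b.val then (1 : ZMod j) else 0)
      ((continuous_apply n).comp continuous_snd) ih

theorem continuous_carryNeg (j : ℕ) (τ : ZMod j → ZMod 2) (n : ℕ) :
    Continuous fun x : AddingMachineSpace j => carryNeg j τ x.1 x.2 n := by
  induction n with
  | zero =>
    exact (continuous_of_discreteTopology (f := fun a : ZMod j => τ (a + 1))).comp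
      ((continuous_apply 0).comp continuous_snd)
  | succ n ih =>
    exact continuous_op_aux (fun a b : ZMod 2 => if 2 ≤ a.val + b.val then (1 : ZMod 2) else 0)
      ((continuous_apply n).comp continuous_fst) ih

/-- The bilateral adding machine map `f_α : Δ → Δ` is continuous (for the product
topology on `Δ`, the factors being discrete). -/
theorem addingMachine_continuous (j : ℕ) (hj : 2 ≤ j) (τ : ZMod j → ZMod 2)
    (hτ : Function.Surjective τ) :
    Continuous (addingMachine j τ) := by
  refine Continuous.prodMk (continuous_pi fun n => ?_) (continuous_pi fun n => ?_)
  · exact continuous_op_aux (fun a b : ZMod 2 => a + b)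
      ((continuous_apply n).comp continuous_fst) (continuous_carryNeg j τ n)
  · exact continuous_op_aux (fun a b : ZMod j => a + b)
      ((continuous_apply n).comp continuous_snd) (continuous_carryPos j n)
end

section
/- The zip shift σ_τ : Σ → Σ is a continuous surjection and a local homeomorphism: every point of Σ has an open neighborhood that σ_τ maps homeomorphically onto an open subset of Σ. -/
/-- The `(Z,S)`-full zip space `Σ`: a point `(u, v)` is a bisequence with negative
coordinates `x_{-(n+1)} := u n ∈ Z` and nonnegative coordinates `x_n := v n ∈ S`. -/
abbrev ZipSpace (Z S : Type*) : Type _ := (ℕ → Z) × (ℕ → S)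

/-- The zip shift `σ_τ : Σ → Σ`: `(σ_τ x)_i = x_{i+1}` for `i ≠ -1` and
`(σ_τ x)_{-1} = τ(x_0)`. -/
def zipShift {Z S : Type*} (τ : S → Z) (x : ZipSpace Z S) : ZipSpace Z S :=
  (fun n => match n with
    | 0 => τ (x.2 0)
    | m + 1 => x.1 m,
   fun n => x.2 (n + 1))

def zipInv {Z S : Type*} (s : S) (y : ZipSpace Z S) : ZipSpace Z S :=
  (fun n => y.1 (n + 1), fun n => match n with
    | 0 => s
    | m + 1 => y.2 m)

theorem zipShift_zipInv {Z S : Type*} (τ : S → Z) (s : S) (y : ZipSpace Z S)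
    (h : y.1 0 = τ s) : zipShift τ (zipInv s y) = y := by
  refine Prod.ext (funext fun n => ?_) (funext fun n => ?_)
  · cases n with
    | zero => exact h.symm
    | succ m => rfl
  · rfl

theorem zipInv_zipShift {Z S : Type*} (τ : S → Z) (s : S) (x : ZipSpace Z S)
    (h : x.2 0 = s) : zipInv s (zipShift τ x) = x := by
  refine Prod.ext (funext fun n => ?_) (funext fun n => ?_)
  · rfl
  · cases n with
    | zero => exact h.symm
    | succ m => rfl

theorem zipInv_continuous {Z S : Type*} [TopologicalSpace Z] [TopologicalSpace S] (s : S) :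
    Continuous (zipInv s : ZipSpace Z S → ZipSpace Z S) := by
  refine Continuous.prodMk (continuous_pi fun n => ?_) (continuous_pi fun n => ?_)
  · fun_prop
  · cases n with
    | zero => exact continuous_const
    | succ m => exact (continuous_apply m).comp continuous_snd

theorem zipShift_cont {Z S : Type*} [TopologicalSpace Z] [TopologicalSpace S]
    [DiscreteTopology S] (τ : S → Z) : Continuous (zipShift τ) := by
  refine Continuous.prodMk (continuous_pi fun n => ?_) (continuous_pi fun n => ?_)
  · cases n with
    | zero =>
      exact (continuous_of_discreteTopology (f := τ)).comp
        (by fun_prop)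
    | succ m => exact (continuous_apply m).comp continuous_fst
  · fun_prop

/-- The zip shift `σ_τ : Σ → Σ` is a continuous surjection and a local
homeomorphism: every point of `Σ` has an open neighborhood that `σ_τ` maps
homeomorphically onto an open subset of `Σ`. -/
theorem zipShift_continuous_surjective_isLocalHomeomorph
    {Z S : Type*} [Finite Z] [Finite S] [Nonempty Z] [Nonempty S]
    [TopologicalSpace Z] [DiscreteTopology Z] [TopologicalSpace S] [DiscreteTopology S]
    (τ : S → Z) (hτ : Function.Surjective τ) :
    Continuous (zipShift τ) ∧ Function.Surjective (zipShift τ) ∧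
      IsLocalHomeomorph (zipShift τ) := by
  refine ⟨zipShift_cont τ, fun y => ?_, IsLocalHomeomorph.mk _ fun x => ?_⟩
  · obtain ⟨s, hs⟩ := hτ (y.1 0)
    exact ⟨zipInv s y, zipShift_zipInv τ s y hs.symm⟩
  · refine ⟨{ toFun := zipShift τ
              invFun := zipInv (x.2 0)
              source := (fun w : ZipSpace Z S => w.2 0) ⁻¹' {x.2 0}
              target := (fun y : ZipSpace Z S => y.1 0) ⁻¹' {τ (x.2 0)}
              map_source' := fun w hw => congrArg τ hw
              map_target' := fun y _ => rfl
              left_inv' := fun w hw => zipInv_zipShift τ _ w hw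
              right_inv' := fun y hy => zipShift_zipInv τ _ y hy
              open_source := (isOpen_discrete {x.2 0}).preimage
                (by fun_prop)
              open_target := (isOpen_discrete {τ (x.2 0)}).preimage
                (by fun_prop)
              continuousOn_toFun := (zipShift_cont τ).continuousOn
              continuousOn_invFun := (zipInv_continuous _).continuousOn }, rfl, fun _ _ => rfl⟩
end

section
/- The zip shift σ_τ is S-expansive with expansivity constant 1/2: for all x, y ∈ Σ with x ≠ y, either there exists m ∈ ℕ such that d(σ_τ^[m](x), σ_τ^[m](y)) > 1/2, or there exists m ∈ ℕ, m ≥ 1, such that for all x', y' ∈ Σ with σ_τ^[m](x') = x and σ_τ^[m](y') = y one has d(x', y') > 1/2. -/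
/-- `diffAt x y n` says the bisequences `x` and `y` differ at some coordinate of
absolute value `n` (the coordinate `x_n` is `x.2 n`, and `x_{-(m+1)}` is `x.1 m`,
of absolute value `m + 1`). -/
def diffAt {A B : Type*} (x y : (ℕ → A) × (ℕ → B)) (n : ℕ) : Prop :=
  x.2 n ≠ y.2 n ∨ ∃ m : ℕ, n = m + 1 ∧ x.1 m ≠ y.1 m

open Classical in
/-- The metric `d(x,y) = 2 ^ (-M(x,y))` for `x ≠ y` (and `0` for `x = y`), where
`M(x,y) = min {|i| : i ∈ ℤ, x_i ≠ y_i}`. -/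
noncomputable def seqDist {A B : Type*} (x y : (ℕ → A) × (ℕ → B)) : ℝ :=
  if h : ∃ n, diffAt x y n then (1 / 2 : ℝ) ^ (Nat.find h) else 0

theorem seqDist_gt_half {A B : Type*} (x y : (ℕ → A) × (ℕ → B)) (h0 : x.2 0 ≠ y.2 0) :
    seqDist x y > 1 / 2 := by
  classical
  have h : ∃ n, diffAt x y n := ⟨0, Or.inl h0⟩
  have hf : Nat.find h = 0 := (Nat.find_eq_zero h).2 (Or.inl h0)
  unfold seqDist
  rw [dif_pos h]
  have : (1 / 2 : ℝ) ^ (Nat.find h) > 1 / 2 := by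
    rw [hf]; norm_num
  convert this

theorem zipShift_iter_snd {Z S : Type*} (τ : S → Z) (x : ZipSpace Z S) (m n : ℕ) :
    ((zipShift τ)^[m] x).2 n = x.2 (n + m) := by
  induction m generalizing n with
  | zero => rfl
  | succ k ih =>
    rw [Function.iterate_succ_apply']
    change ((zipShift τ)^[k] x).2 (n + 1) = _
    rw [ih, show n + 1 + k = n + (k + 1) by omega]

theorem zipShift_iter_fst {Z S : Type*} (τ : S → Z) (x : ZipSpace Z S) (k : ℕ) :
    ((zipShift τ)^[k + 1] x).1 k = τ (x.2 0) := by
  induction k with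
  | zero => rfl
  | succ k ih =>
    rw [Function.iterate_succ_apply']
    exact ih

/-- The zip shift `σ_τ` is S-expansive with expansivity constant `1/2`: for all
`x ≠ y` in `Σ`, either some forward iterate separates them by more than `1/2`, or
there is `m ≥ 1` such that every pair of `m`-th preimages of `x` and `y` is
separated by more than `1/2`. -/
theorem zipShift_sExpansive
    {Z S : Type*} [Finite Z] [Finite S] [Nonempty Z] [Nonempty S]
    [TopologicalSpace Z] [DiscreteTopology Z] [TopologicalSpace S] [DiscreteTopology S]
    (τ : S → Z) (hτ : Function.Surjective τ)
    (x y : ZipSpace Z S) (hxy : x ≠ y) :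
    (∃ m : ℕ, seqDist ((zipShift τ)^[m] x) ((zipShift τ)^[m] y) > 1 / 2) ∨
    (∃ m : ℕ, 1 ≤ m ∧ ∀ x' y' : ZipSpace Z S,
      (zipShift τ)^[m] x' = x → (zipShift τ)^[m] y' = y → seqDist x' y' > 1 / 2) := by
  by_cases h : ∃ n, x.2 n ≠ y.2 n
  · obtain ⟨n, hn⟩ := h
    refine Or.inl ⟨n, seqDist_gt_half _ _ ?_⟩
    rw [zipShift_iter_snd, zipShift_iter_snd, Nat.zero_add]
    exact hn
  · have h2 : x.2 = y.2 := by
      funext n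
      by_contra hn
      exact h ⟨n, hn⟩
    have h1 : x.1 ≠ y.1 := fun h1 => hxy (Prod.ext h1 h2)
    obtain ⟨k, hk⟩ := Function.ne_iff.1 h1
    refine Or.inr ⟨k + 1, by omega, ?_⟩
    intro x' y' hx hy
    refine seqDist_gt_half _ _ fun h0 => hk ?_
    rw [← hx, ← hy, zipShift_iter_fst, zipShift_iter_fst, h0]
end

section
/- The bilateral adding machine map f_α is not expansive: for every δ > 0 there exist points x ≠ y in Δ such that d(f_α^[n](x), f_α^[n](y)) < δ for all n ∈ ℕ and d(g^[n](x), g^[n](y)) < δ for all n ∈ ℕ, where g denotes the inverse of the homeomorphism f_α. -/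
theorem carryPos_agree (j : ℕ) (v w : ℕ → ZMod j) (n : ℕ) (h : ∀ i < n, v i = w i) :
    carryPos j v n = carryPos j w n := by
  induction n with
  | zero => rfl
  | succ n ih =>
    simp only [carryPos]
    rw [ih (fun i hi => h i (by omega)), h n (by omega)]

theorem carryNeg_agree (j : ℕ) (τ : ZMod j → ZMod 2) (u u' : ℕ → ZMod 2) (v w : ℕ → ZMod j)
    (h0 : v 0 = w 0) (n : ℕ) (h : ∀ i < n, u i = u' i) :
    carryNeg j τ u v n = carryNeg j τ u' w n := by
  induction n with
  | zero => simp only [carryNeg, h0]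
  | succ n ih =>
    simp only [carryNeg]
    rw [ih (fun i hi => h i (by omega)), h n (by omega)]

theorem agree_iff (j : ℕ) (τ : ZMod j → ZMod 2) (N : ℕ) (x y : AddingMachineSpace j) :
    ((∀ i < N + 1, (addingMachine j τ x).1 i = (addingMachine j τ y).1 i) ∧
      (∀ i < N + 1, (addingMachine j τ x).2 i = (addingMachine j τ y).2 i)) ↔
    ((∀ i < N + 1, x.1 i = y.1 i) ∧ (∀ i < N + 1, x.2 i = y.2 i)) := by
  simp only [addingMachine]
  constructor
  · rintro ⟨h1, h2⟩
    have k2 : ∀ i < N + 1, x.2 i = y.2 i := by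
      intro i
      induction i using Nat.strong_induction_on with
      | _ i ih =>
        intro hi
        have := h2 i hi
        rw [carryPos_agree j x.2 y.2 i (fun k hk => ih k hk (by omega))] at this
        exact add_right_cancel this
    refine ⟨?_, k2⟩
    intro i
    induction i using Nat.strong_induction_on with
    | _ i ih =>
      intro hi
      have := h1 i hi
      rw [carryNeg_agree j τ x.1 y.1 x.2 y.2 (k2 0 (by omega)) i
        (fun k hk => ih k hk (by omega))] at this
      exact add_right_cancel this
  · rintro ⟨h1, h2⟩
    refine ⟨fun i hi => ?_, fun i hi => ?_⟩
    · rw [carryNeg_agree j τ x.1 y.1 x.2 y.2 (h2 0 (by omega)) i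
        (fun k hk => h1 k (by omega)), h1 i hi]
    · rw [carryPos_agree j x.2 y.2 i (fun k hk => h2 k (by omega)), h2 i hi]

theorem seqDist_lt_of_agree (j : ℕ) (N : ℕ) (δ : ℝ) (hδ : 0 < δ) (hN : (1 / 2 : ℝ) ^ N < δ)
    (x y : AddingMachineSpace j)
    (h : (∀ i < N + 1, x.1 i = y.1 i) ∧ (∀ i < N + 1, x.2 i = y.2 i)) :
    seqDist x y < δ := by
  classical
  unfold seqDist
  split_ifs with hd
  · refine lt_of_le_of_lt (pow_le_pow_of_le_one (by norm_num) (by norm_num) ?_) hN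
    rw [Nat.le_find_iff]
    rintro m hm (h2 | ⟨k, rfl, h1⟩)
    · exact h2 (h.2 m (by omega))
    · exact h1 (h.1 k (by omega))
  · exact hδ

/-- The bilateral adding machine map `f_α` is not expansive: for every `δ > 0`
there exist points `x ≠ y` in `Δ` with `d(f_α^[n](x), f_α^[n](y)) < δ` and
`d(g^[n](x), g^[n](y)) < δ` for all `n ∈ ℕ`, where `g` is the inverse of the
homeomorphism `f_α`. -/
theorem addingMachine_not_expansive (j : ℕ) (hj : 2 ≤ j) (τ : ZMod j → ZMod 2)
    (hτ : Function.Surjective τ) (g : AddingMachineSpace j → AddingMachineSpace j)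
    (hg₁ : Function.LeftInverse g (addingMachine j τ))
    (hg₂ : Function.RightInverse g (addingMachine j τ))
    (δ : ℝ) (hδ : 0 < δ) :
    ∃ x y : AddingMachineSpace j, x ≠ y ∧
      (∀ n : ℕ, seqDist ((addingMachine j τ)^[n] x) ((addingMachine j τ)^[n] y) < δ) ∧
      (∀ n : ℕ, seqDist (g^[n] x) (g^[n] y) < δ) := by
  obtain ⟨N, hN⟩ := exists_pow_lt_of_lt_one hδ (by norm_num : (1 / 2 : ℝ) < 1)
  have : Fact (1 < j) := ⟨by omega⟩
  refine ⟨(0, 0), (0, Pi.single (N + 1) 1), ?_, ?_, ?_⟩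
  · intro h
    have := congrFun (congrArg Prod.snd h) (N + 1)
    simp at this
  all_goals
    intro n
    apply seqDist_lt_of_agree j N δ hδ hN
    induction n with
    | zero =>
      refine ⟨fun i _ => rfl, fun i hi => ?_⟩
      have : i ≠ N + 1 := by omega
      simp [this]
    | succ n ih =>
      rw [Function.iterate_succ_apply', Function.iterate_succ_apply']
      first
        | exact (agree_iff j τ N _ _).2 ih
        | (rw [← agree_iff j τ N, hg₂, hg₂]; exact ih)
end

section
/- Let X be a compact metric space, f : X → X continuous, and suppose X itself is f-minimal. Let n be a positive integer. Then there exist a positive integer t ≤ n and a set M ⊆ X that is minimal for the iterate f^[n], such that the sets M, f '' M, (f^[2]) '' M, …, (f^[t-1]) '' M are pairwise disjoint, each is clopen in X, and their union equals X. -/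
/-- A set `A ⊆ X` is `f`-minimal if it is nonempty, closed, satisfies
`f '' A ⊆ A`, and contains no nonempty proper closed subset `B` with
`f '' B ⊆ B`. -/
def IsMinimalSet {X : Type*} [TopologicalSpace X] (f : X → X) (A : Set X) : Prop :=
  A.Nonempty ∧ IsClosed A ∧ f '' A ⊆ A ∧
    ∀ B : Set X, B ⊆ A → B.Nonempty → IsClosed B → f '' B ⊆ B → B = A

theorem exists_minimalSet_aux {X : Type*} [TopologicalSpace X] [CompactSpace X] [Nonempty X]
    (g : X → X) : ∃ M : Set X, IsMinimalSet g M := by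
  obtain ⟨M, hM⟩ := zorn_superset {B : Set X | B.Nonempty ∧ IsClosed B ∧ g '' B ⊆ B} (by
    intro c hc hchain
    rcases c.eq_empty_or_nonempty with rfl | hne
    · exact ⟨Set.univ, ⟨Set.univ_nonempty, isClosed_univ, Set.subset_univ _⟩, by simp⟩
    · refine ⟨⋂₀ c, ⟨?_, isClosed_sInter fun s hs => (hc hs).2.1, ?_⟩,
        fun s hs => Set.sInter_subset_of_mem hs⟩
      · haveI := hne.to_subtype
        refine IsCompact.nonempty_sInter_of_directed_nonempty_isCompact_isClosed ?_
          (fun s hs => (hc hs).1) (fun s hs => (hc hs).2.1.isCompact) (fun s hs => (hc hs).2.1)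
        exact fun x hx y hy => (hchain.total hx hy).elim (fun h => ⟨x, hx, subset_rfl, h⟩)
          (fun h => ⟨y, hy, h, subset_rfl⟩)
      · rintro _ ⟨x, hx, rfl⟩ s hs
        exact (hc hs).2.2 ⟨x, hx s hs, rfl⟩)
  refine ⟨M, hM.prop.1, hM.prop.2.1, hM.prop.2.2, fun B hBM h1 h2 h3 => ?_⟩
  exact hBM.antisymm (hM.le_of_le ⟨h1, h2, h3⟩ hBM)

theorem IsMinimalSet.iter_image_aux {X : Type*} [TopologicalSpace X] [CompactSpace X] [T2Space X]
    {f : X → X} (hf : Continuous f) {n : ℕ} {M : Set X} (hM : IsMinimalSet (f^[n]) M) (i : ℕ) :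
    IsMinimalSet (f^[n]) (f^[i] '' M) := by
  have comm : ∀ x, f^[n] (f^[i] x) = f^[i] (f^[n] x) := fun x => by
    rw [← Function.iterate_add_apply, ← Function.iterate_add_apply, add_comm]
  refine ⟨hM.1.image _, (hM.2.1.isCompact.image (hf.iterate i)).isClosed, ?_, ?_⟩
  · rintro _ ⟨_, ⟨x, hx, rfl⟩, rfl⟩
    exact ⟨f^[n] x, hM.2.2.1 ⟨x, hx, rfl⟩, (comm x).symm⟩
  · intro B hB hne hcl hinv
    refine hB.antisymm ?_
    have h := hM.2.2.2 (M ∩ f^[i] ⁻¹' B) Set.inter_subset_left ?_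
      (hM.2.1.inter (hcl.preimage (hf.iterate i))) ?_
    · rintro _ ⟨x, hx, rfl⟩
      rw [← h] at hx
      exact hx.2
    · obtain ⟨b, hb⟩ := hne
      obtain ⟨x, hx, rfl⟩ := hB hb
      exact ⟨x, hx, hb⟩
    · rintro _ ⟨x, ⟨hx, hxB⟩, rfl⟩
      refine ⟨hM.2.2.1 ⟨x, hx, rfl⟩, ?_⟩
      show f^[i] (f^[n] x) ∈ B
      rw [← comm]
      exact hinv ⟨_, hxB, rfl⟩

theorem IsMinimalSet.eq_of_not_disjoint_aux {X : Type*} [TopologicalSpace X]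
    {g : X → X} {A B : Set X} (hA : IsMinimalSet g A) (hB : IsMinimalSet g B)
    (h : ¬ Disjoint A B) : A = B := by
  have hne := Set.not_disjoint_iff_nonempty_inter.1 h
  have hcl := hA.2.1.inter hB.2.1
  have hinv : g '' (A ∩ B) ⊆ A ∩ B := by
    rintro _ ⟨x, ⟨hx, hy⟩, rfl⟩
    exact ⟨hA.2.2.1 ⟨x, hx, rfl⟩, hB.2.2.1 ⟨x, hy, rfl⟩⟩
  rw [← hA.2.2.2 _ Set.inter_subset_left hne hcl hinv]
  exact hB.2.2.2 _ Set.inter_subset_right hne hcl hinv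

/-- Let `X` be a compact metric space, `f : X → X` continuous, and suppose `X` is
`f`-minimal. For every positive integer `n` there exist a positive integer `t ≤ n`
and a set `M ⊆ X` minimal for `f^[n]` such that the sets
`M, f '' M, …, (f^[t-1]) '' M` are pairwise disjoint, each is clopen in `X`, and
their union is `X`. -/
theorem exists_clopen_cyclic_decomposition {X : Type*} [MetricSpace X]
    [CompactSpace X] (f : X → X) (hf : Continuous f)
    (hmin : IsMinimalSet f Set.univ) (n : ℕ) (hn : 0 < n) :
    ∃ t : ℕ, 0 < t ∧ t ≤ n ∧ ∃ M : Set X, IsMinimalSet (f^[n]) M ∧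
      (∀ i < t, ∀ l < t, i ≠ l → Disjoint (f^[i] '' M) (f^[l] '' M)) ∧
      (∀ i < t, IsClopen (f^[i] '' M)) ∧
      (⋃ i ∈ Finset.range t, f^[i] '' M) = Set.univ := by
  classical
  haveI : Nonempty X := ⟨hmin.1.some⟩
  obtain ⟨M, hM⟩ := exists_minimalSet_aux (f^[n])
  have him := fun i => hM.iter_image_aux hf i
  have hadd : ∀ i j, f^[i] '' (f^[j] '' M) = f^[i + j] '' M := fun i j => by
    rw [Function.iterate_add, Set.image_comp]
  have hex : ∃ t, 0 < t ∧ f^[t] '' M = M :=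
    ⟨n, hn, hM.2.2.2 _ hM.2.2.1 (him n).1 (him n).2.1 (him n).2.2.1⟩
  obtain ⟨ht0, htM⟩ := Nat.find_spec hex
  have htn : Nat.find hex ≤ n :=
    Nat.find_min' hex ⟨hn, hM.2.2.2 _ hM.2.2.1 (him n).1 (him n).2.1 (him n).2.2.1⟩
  have hlt : ∀ m < Nat.find hex, 0 < m → f^[m] '' M ≠ M :=
    fun m hm h0 h => Nat.find_min hex hm ⟨h0, h⟩
  generalize Nat.find hex = t at ht0 htM htn hlt
  have hd : ∀ i l, i < l → l < t → Disjoint (f^[i] '' M) (f^[l] '' M) := by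
    intro i l hil hl
    by_contra hnd
    have heq := (him i).eq_of_not_disjoint_aux (him l) hnd
    refine hlt (t - l + i) (by omega) (by omega) ?_
    rw [← hadd, heq, hadd, Nat.sub_add_cancel hl.le, htM]
  have hdis : ∀ i < t, ∀ l < t, i ≠ l → Disjoint (f^[i] '' M) (f^[l] '' M) := by
    intro i hi l hl hne
    rcases lt_or_gt_of_ne hne with h | h
    · exact hd i l h hl
    · exact (hd l i h hi).symm
  have hU : (⋃ i ∈ Finset.range t, f^[i] '' M) = Set.univ := by
    refine hmin.2.2.2 _ (Set.subset_univ _) ?_ ?_ ?_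
    · obtain ⟨x, hx⟩ := hM.1
      exact ⟨x, Set.mem_biUnion (Finset.mem_coe.2 (Finset.mem_range.2 ht0)) ⟨x, hx, rfl⟩⟩
    · exact isClosed_biUnion_finset fun i _ => (him i).2.1
    · rintro _ ⟨y, hy, rfl⟩
      simp only [Set.mem_iUnion, Finset.mem_range, exists_prop] at hy ⊢
      obtain ⟨i, hi, x, hx, rfl⟩ := hy
      rw [← Function.iterate_succ_apply' f i x]
      by_cases h : i + 1 < t
      · exact ⟨i + 1, h, x, hx, rfl⟩
      · have : i + 1 = t := by omega
        refine ⟨0, ht0, f^[i + 1] x, ?_, rfl⟩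
        rw [this, ← htM]
        exact ⟨x, hx, rfl⟩
  refine ⟨t, ht0, htn, M, hM, hdis, fun i hi => ⟨(him i).2.1, ?_⟩, hU⟩
  have hc : f^[i] '' M = (⋃ l ∈ (Finset.range t).erase i, f^[l] '' M)ᶜ := by
    ext x
    simp only [Set.mem_compl_iff, Set.mem_iUnion, Finset.mem_erase, Finset.mem_range, exists_prop,
      not_exists, not_and]
    constructor
    · intro hx l hl hxl
      exact Set.disjoint_left.1 (hdis i hi l hl.2 (Ne.symm hl.1)) hx hxl
    · intro h
      have hx : x ∈ ⋃ i ∈ Finset.range t, f^[i] '' M := hU ▸ Set.mem_univ x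
      simp only [Set.mem_iUnion, Finset.mem_range, exists_prop] at hx
      obtain ⟨l, hl, hxl⟩ := hx
      by_cases hli : l = i
      · exact hli ▸ hxl
      · exact absurd hxl (h l ⟨hli, hl⟩)
  rw [hc]
  exact (isClosed_biUnion_finset fun l _ => (him l).2.1).isOpen_compl
end

section
/- Let X be a compact Hausdorff space, f : X → X continuous, and n a positive integer. If M ⊆ X is f^[n]-minimal, then for every i ∈ ℕ the image (f^[i]) '' M is also f^[n]-minimal. -/
/-- Let `X` be a compact Hausdorff space, `f : X → X` continuous, and `n` a
positive integer. If `M ⊆ X` is `f^[n]`-minimal, then for every `i ∈ ℕ` the image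
`(f^[i]) '' M` is also `f^[n]`-minimal. -/
theorem image_of_minimal_isMinimal {X : Type*} [TopologicalSpace X]
    [CompactSpace X] [T2Space X] (f : X → X) (hf : Continuous f)
    (n : ℕ) (hn : 0 < n) (M : Set X) (hM : IsMinimalSet (f^[n]) M) (i : ℕ) :
    IsMinimalSet (f^[n]) (f^[i] '' M) := by
  obtain ⟨hne, hcl, hinv, hmin⟩ := hM
  have hc : Continuous (f^[i]) := hf.iterate i
  have comm : ∀ x, f^[n] (f^[i] x) = f^[i] (f^[n] x) := fun x => by
    rw [← Function.iterate_add_apply, ← Function.iterate_add_apply, Nat.add_comm]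
  refine ⟨hne.image _, (hcl.isCompact.image hc).isClosed, ?_, ?_⟩
  · rintro _ ⟨_, ⟨x, hx, rfl⟩, rfl⟩
    exact ⟨f^[n] x, hinv ⟨x, hx, rfl⟩, (comm x).symm⟩
  · intro B hB hBne hBcl hBinv
    have key : M ∩ f^[i] ⁻¹' B = M := by
      apply hmin _ Set.inter_subset_left
      · obtain ⟨b, hb⟩ := hBne
        obtain ⟨x, hx, rfl⟩ := hB hb
        exact ⟨x, hx, hb⟩
      · exact hcl.inter (hBcl.preimage hc)
      · rintro _ ⟨x, ⟨hx, hxB⟩, rfl⟩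
        refine ⟨hinv ⟨x, hx, rfl⟩, ?_⟩
        show f^[i] (f^[n] x) ∈ B
        rw [← comm]
        exact hBinv ⟨_, hxB, rfl⟩
    apply Set.Subset.antisymm hB
    rintro _ ⟨x, hx, rfl⟩
    rw [← key] at hx
    exact hx.2
end

section
/- Let X be a compact metric space, f : X → X continuous, and suppose X itself is f-minimal. Then for every positive integer n and every x ∈ X, the closure of the set {f^[n*k](x) : k ∈ ℕ} is an f^[n]-minimal set. -/
/-- Let `X` be a compact metric space, `f : X → X` continuous, and suppose `X` is
`f`-minimal. Then for every positive integer `n` and every `x ∈ X`, the closure of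
`{f^[n*k](x) : k ∈ ℕ}` is an `f^[n]`-minimal set. -/
theorem closure_orbit_iterate_isMinimal {X : Type*} [MetricSpace X]
    [CompactSpace X] (f : X → X) (hf : Continuous f)
    (hmin : IsMinimalSet f Set.univ) (n : ℕ) (hn : 0 < n) (x : X) :
    IsMinimalSet (f^[n]) (closure (Set.range fun k : ℕ => f^[n * k] x)) := by
  have : Nonempty X := ⟨x⟩
  obtain ⟨M, hMne, hMc, hMi, hMm⟩ := exists_minimalSet_aux (f^[n])
  have hcomm : ∀ i y, f^[n] (f^[i] y) = f^[i] (f^[n] y) := fun i y => by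
    rw [← Function.iterate_add_apply, ← Function.iterate_add_apply, add_comm]
  have hU : (⋃ i ∈ Finset.range n, f^[i] '' M) = Set.univ := by
    refine hmin.2.2.2 _ (Set.subset_univ _) ?_ ?_ ?_
    · obtain ⟨m, hm⟩ := hMne
      exact ⟨m, Set.mem_biUnion (Finset.mem_range.2 hn) ⟨m, hm, rfl⟩⟩
    · exact isClosed_biUnion_finset fun i _ => (hMc.isCompact.image (hf.iterate i)).isClosed
    · rintro _ ⟨y, hy, rfl⟩
      simp only [Set.mem_iUnion, Finset.mem_range] at hy ⊢
      obtain ⟨i, hi, m, hm, rfl⟩ := hy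
      rw [← Function.iterate_succ_apply' f i m]
      by_cases h : i + 1 < n
      · exact ⟨i + 1, h, m, hm, rfl⟩
      · have : i.succ = n := by omega
        rw [this]
        exact ⟨0, hn, f^[n] m, hMi ⟨m, hm, rfl⟩, rfl⟩
  have hx : x ∈ ⋃ i ∈ Finset.range n, f^[i] '' M := hU ▸ Set.mem_univ x
  simp only [Set.mem_iUnion] at hx
  obtain ⟨i, -, hx⟩ := hx
  have hNc : IsClosed (f^[i] '' M) := (hMc.isCompact.image (hf.iterate i)).isClosed
  have hNi : ∀ y ∈ f^[i] '' M, f^[n] y ∈ f^[i] '' M := by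
    rintro _ ⟨m, hm, rfl⟩
    exact ⟨f^[n] m, hMi ⟨m, hm, rfl⟩, (hcomm i m).symm⟩
  have hNm : ∀ B : Set X, B ⊆ f^[i] '' M → B.Nonempty → IsClosed B → f^[n] '' B ⊆ B →
      B = f^[i] '' M := by
    intro B hB hne hc hi
    refine Set.Subset.antisymm hB ?_
    have := hMm (M ∩ f^[i] ⁻¹' B) Set.inter_subset_left ?_
      (hMc.inter (hc.preimage (hf.iterate i))) ?_
    · rintro _ ⟨m, hm, rfl⟩
      rw [← this] at hm
      exact hm.2
    · obtain ⟨b, hb⟩ := hne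
      obtain ⟨m, hm, rfl⟩ := hB hb
      exact ⟨m, hm, hb⟩
    · rintro _ ⟨m, ⟨hm, hb⟩, rfl⟩
      refine ⟨hMi ⟨m, hm, rfl⟩, ?_⟩
      rw [Set.mem_preimage, ← hcomm]
      exact hi ⟨_, hb, rfl⟩
  have hs : ∀ k, f^[n * (k + 1)] x = f^[n] (f^[n * k] x) := fun k => by
    rw [← Function.iterate_add_apply, Nat.mul_succ, add_comm]
  have hcl : closure (Set.range fun k : ℕ => f^[n * k] x) = f^[i] '' M := by
    refine hNm _ ?_ ⟨x, subset_closure ⟨0, rfl⟩⟩ isClosed_closure ?_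
    · refine closure_minimal ?_ hNc
      rintro _ ⟨k, rfl⟩
      induction k with
      | zero => exact hx
      | succ k ih =>
        simp only [hs] at ih ⊢
        exact hNi _ ih
    · refine (image_closure_subset_closure_image (hf.iterate n)).trans (closure_mono ?_)
      rintro _ ⟨_, ⟨k, rfl⟩, rfl⟩
      exact ⟨k + 1, hs k⟩
  rw [hcl]
  exact ⟨⟨x, hx⟩, hNc, Set.image_subset_iff.2 hNi, hNm⟩
end

section
/- Let X be a compact metric space, f : X → X continuous, and suppose X itself is f-minimal. Let n > 1 be an integer. If there exists a proper closed subset M ⊊ X that is f^[n]-minimal but not f^[t]-minimal for any positive integer t < n, then there exists a continuous map π : X → ZMod n (with ZMod n discrete) such that π(f(x)) = π(x) + 1 for every x ∈ X. -/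
/-- Let `X` be a compact metric space, `f : X → X` continuous, and suppose `X` is
`f`-minimal. Let `n > 1`. If there is a proper closed subset `M ⊊ X` that is
`f^[n]`-minimal but not `f^[t]`-minimal for any positive integer `t < n`, then
there is a continuous map `π : X → ZMod n` with `π (f x) = π x + 1` for all `x`. -/
theorem exists_continuous_factor_onto_zmod {X : Type*} [MetricSpace X]
    [CompactSpace X] (f : X → X) (hf : Continuous f)
    (hmin : IsMinimalSet f Set.univ) (n : ℕ) (hn : 1 < n)
    (M : Set X) (hMproper : M ≠ Set.univ) (hMclosed : IsClosed M)
    (hM : IsMinimalSet (f^[n]) M)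
    (hMnot : ∀ t : ℕ, 0 < t → t < n → ¬ IsMinimalSet (f^[t]) M) :
    ∃ π : X → ZMod n, Continuous π ∧ ∀ x : X, π (f x) = π x + 1 := by
  have : NeZero n := ⟨by omega⟩
  obtain ⟨hne, -, hinv, hm⟩ := hM
  obtain ⟨S, hS⟩ : ∃ S : ℕ → Set X, ∀ k, S k = f^[k] '' M := ⟨_, fun _ => rfl⟩
  have hadd : ∀ a b, S (a + b) = f^[a] '' S b := by
    intro a b
    rw [hS, hS, Function.iterate_add, Set.image_comp]
  have h0 : S 0 = M := by simp [hS]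
  have hcl : ∀ k, IsClosed (S k) := fun k => by
    rw [hS]; exact (hMclosed.isCompact.image (hf.iterate k)).isClosed
  have hSn : S n = M := by
    rw [hS]
    refine hm _ hinv (hne.image _) (hS n ▸ hcl n) (Set.image_mono hinv)
  have hper : ∀ a b, S a = M → S (b + a) = S b := by
    intro a b h
    rw [hadd, h, ← hS]
  have hmul : ∀ a q, S a = M → S (q * a) = M := by
    intro a q h
    induction q with
    | zero => simpa using h0
    | succ q ih => rw [Nat.succ_mul, hper _ _ h, ih]
  have hsub : ∀ k (B : Set X), B ⊆ S k → B.Nonempty → IsClosed B →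
      f^[n] '' B ⊆ B → S k ⊆ B := by
    intro k B hB hBne hBc hBi
    have : M ∩ f^[k] ⁻¹' B = M := by
      apply hm _ Set.inter_subset_left
      · obtain ⟨y, hy⟩ := hBne
        have := hB hy
        rw [hS] at this
        obtain ⟨x, hx, rfl⟩ := this
        exact ⟨x, hx, hy⟩
      · exact hMclosed.inter (hBc.preimage (hf.iterate k))
      · rintro _ ⟨x, ⟨hx, hxB⟩, rfl⟩
        refine ⟨hinv ⟨x, hx, rfl⟩, ?_⟩
        show f^[k] (f^[n] x) ∈ B
        rw [← Function.iterate_add_apply, add_comm, Function.iterate_add_apply]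
        exact hBi ⟨_, hxB, rfl⟩
    rw [hS]
    rintro _ ⟨x, hx, rfl⟩
    rw [← this] at hx
    exact hx.2
  have hSinv : ∀ k, f^[n] '' S k ⊆ S k := by
    intro k
    rw [← hadd, add_comm, hper _ _ hSn]
  have heq : ∀ i j x, x ∈ S i → x ∈ S j → S i = S j := by
    intro i j x hi hj
    have hBi : f^[n] '' (S i ∩ S j) ⊆ S i ∩ S j := by
      rintro _ ⟨y, ⟨h1, h2⟩, rfl⟩
      exact ⟨hSinv i ⟨y, h1, rfl⟩, hSinv j ⟨y, h2, rfl⟩⟩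
    have hc := (hcl i).inter (hcl j)
    apply Set.Subset.antisymm
    · exact (hsub i _ Set.inter_subset_left ⟨x, hi, hj⟩ hc hBi).trans Set.inter_subset_right
    · exact (hsub j _ Set.inter_subset_right ⟨x, hi, hj⟩ hc hBi).trans Set.inter_subset_left
  have hdvd : ∀ t, S t = M → n ∣ t := by
    intro t ht
    have himg : ∀ k, (Set.image f)^[k] M = S k := by
      intro k
      rw [hS, Set.image_iterate_eq]
    have h1 : Function.IsPeriodicPt (Set.image f) t M := (himg t).trans ht
    have h2 : Function.IsPeriodicPt (Set.image f) n M := (himg n).trans hSn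
    have h3 : S (t.gcd n) = M := (himg _).symm.trans (h1.gcd h2)
    by_contra hnd
    have hd : t.gcd n ∣ n := Nat.gcd_dvd_right _ _
    have hlt : t.gcd n < n := by
      refine lt_of_le_of_ne (Nat.le_of_dvd (by omega) hd) fun h => hnd ?_
      rw [← h]; exact Nat.gcd_dvd_left _ _
    refine hMnot _ (Nat.gcd_pos_of_pos_right _ (by omega)) hlt
      ⟨hne, hMclosed, by rw [← hS, h3], fun B hB hBne hBc hBi => hm B hB hBne hBc ?_⟩
    obtain ⟨q, hq⟩ := hd
    have hmaps : Set.MapsTo f^[t.gcd n] B B := Set.mapsTo_iff_image_subset.2 hBi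
    have := hmaps.iterate q
    rw [← Function.iterate_mul, ← hq] at this
    exact Set.mapsTo_iff_image_subset.1 this
  have hmod' : ∀ i t, S i = S (i + t) → n ∣ t := by
    intro i t h
    apply hdvd
    have h1 : S ((n - 1) * i + i) = S ((n - 1) * i + (i + t)) := by
      rw [hadd, h, ← hadd]
    have h2 : (n - 1) * i + i = i * n := by
      obtain ⟨m, rfl⟩ : ∃ m, n = m + 1 := ⟨n - 1, by omega⟩
      simp; ring
    rw [← add_assoc, h2, add_comm, hper _ _ (hmul n i hSn), hmul n i hSn] at h1
    exact h1.symm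
  have hmod : ∀ i j x, x ∈ S i → x ∈ S j → (i : ZMod n) = j := by
    intro i j x hi hj
    have h := heq i j x hi hj
    rcases le_total i j with hij | hij
    · obtain ⟨t, rfl⟩ := Nat.exists_eq_add_of_le hij
      have := (ZMod.natCast_eq_zero_iff t n).2 (hmod' _ _ h)
      simp [this]
    · obtain ⟨t, rfl⟩ := Nat.exists_eq_add_of_le hij
      have := (ZMod.natCast_eq_zero_iff t n).2 (hmod' _ _ h.symm)
      simp [this]
  have hval : ∀ k : ℕ, S ((k : ZMod n).val) = S k := by
    intro k
    rw [ZMod.val_natCast]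
    conv_rhs => rw [← Nat.mod_add_div k n, mul_comm n]
    rw [hper _ _ (hmul n _ hSn)]
  have hsucc : ∀ k x, x ∈ S k → f x ∈ S (k + 1) := by
    intro k x hx
    rw [add_comm, hadd]
    exact ⟨x, hx, rfl⟩
  have hcover : ∀ x, ∃ k, x ∈ S k := by
    have hU : (⋃ c : ZMod n, S c.val) = Set.univ := by
      apply hmin.2.2.2 _ (Set.subset_univ _)
      · obtain ⟨x, hx⟩ := hne
        refine ⟨x, Set.mem_iUnion.2 ⟨0, ?_⟩⟩
        rw [ZMod.val_zero, h0]; exact hx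
      · exact isClosed_iUnion_of_finite fun c => hcl _
      · rintro _ ⟨x, hx, rfl⟩
        obtain ⟨c, hc⟩ := Set.mem_iUnion.1 hx
        refine Set.mem_iUnion.2 ⟨((c.val + 1 : ℕ) : ZMod n), ?_⟩
        rw [hval]
        exact hsucc _ _ hc
    intro x
    obtain ⟨c, hc⟩ := Set.mem_iUnion.1 (hU ▸ Set.mem_univ x)
    exact ⟨_, hc⟩
  choose p hp using hcover
  refine ⟨fun x => (p x : ZMod n), ?_, ?_⟩
  · rw [continuous_iff_isClosed]
    intro s _
    have : (fun x => (p x : ZMod n)) ⁻¹' s = ⋃ c ∈ s, S c.val := by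
      ext x
      simp only [Set.mem_preimage, Set.mem_iUnion, exists_prop]
      constructor
      · intro h
        exact ⟨_, h, by rw [hval]; exact hp x⟩
      · rintro ⟨c, hc, hx⟩
        have := hmod _ _ x (hp x) hx
        rw [ZMod.natCast_zmod_val] at this
        rwa [this]
    rw [this]
    exact s.toFinite.isClosed_biUnion fun c _ => hcl _
  · intro x
    have := hmod _ _ _ (hp (f x)) (hsucc _ _ (hp x))
    simpa using this
end

section
/- Let X be an infinite compact metric space, f : X → X continuous, suppose X itself is f-minimal, and suppose there exists a regularly recurrent point x ∈ X. Then the set S(f) is infinite. -/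
/-- `S(f)` is the set of positive integers `n` for which some `M ⊆ X` is
`f^[n]`-minimal but not `f^[t]`-minimal for any positive integer `t < n`. -/
def Sset {X : Type*} [TopologicalSpace X] (f : X → X) : Set ℕ :=
  {n | 0 < n ∧ ∃ M : Set X, IsMinimalSet (f^[n]) M ∧
    ∀ t : ℕ, 0 < t → t < n → ¬ IsMinimalSet (f^[t]) M}

/-- A point `x` is regularly recurrent for `f` if for every neighborhood `V` of
`x` there is a positive integer `n` with `f^[n*k](x) ∈ V` for every `k ∈ ℕ`. -/
def RegularlyRecurrent {X : Type*} [TopologicalSpace X] (f : X → X) (x : X) : Prop :=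
  ∀ V ∈ nhds x, ∃ n : ℕ, 0 < n ∧ ∀ k : ℕ, f^[n * k] x ∈ V

theorem rr_orbit_minimal {X : Type*} [MetricSpace X] (g : X → X) (hg : Continuous g) (x : X)
    (hx : RegularlyRecurrent g x) :
    IsMinimalSet g (closure (Set.range fun k : ℕ => g^[k] x)) := by
  refine ⟨⟨x, subset_closure ⟨0, rfl⟩⟩, isClosed_closure, ?_, ?_⟩
  · refine (image_closure_subset_closure_image hg).trans (closure_mono ?_)
    rintro _ ⟨_, ⟨k, rfl⟩, rfl⟩
    exact ⟨k + 1, Function.iterate_succ_apply' g k x⟩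
  · intro B hBM ⟨b, hb⟩ hBc hBi
    have hit : ∀ i : ℕ, ∀ z ∈ B, g^[i] z ∈ B := by
      intro i
      induction i with
      | zero => intro z hz; exact hz
      | succ i ih => intro z hz; exact ih _ (hBi ⟨z, hz, rfl⟩)
    have hxB : x ∈ B := by
      by_contra hxB
      obtain ⟨V, hV, hVc, hVB⟩ :=
        exists_mem_nhds_isClosed_subset (hBc.isOpen_compl.mem_nhds hxB)
      obtain ⟨m, hm, hmV⟩ := hx V hV
      have hcl : IsClosed (⋃ i ∈ Set.Iic m, (g^[i]) ⁻¹' V) :=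
        (Set.finite_Iic m).isClosed_biUnion fun i _ => hVc.preimage (hg.iterate i)
      have hsub : closure (Set.range fun k : ℕ => g^[k] x) ⊆ ⋃ i ∈ Set.Iic m, (g^[i]) ⁻¹' V := by
        refine closure_minimal ?_ hcl
        rintro _ ⟨k, rfl⟩
        simp only [Set.mem_iUnion, Set.mem_preimage, Set.mem_Iic]
        refine ⟨m - k % m, Nat.sub_le _ _, ?_⟩
        rw [← Function.iterate_add_apply]
        have h1 := Nat.mod_lt k hm
        have h2 := Nat.div_add_mod k m
        have : m - k % m + k = m * (k / m + 1) := by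
          rw [mul_add, mul_one]; omega
        rw [this]
        exact hmV _
      have hbU := hsub (hBM hb)
      simp only [Set.mem_iUnion, Set.mem_preimage] at hbU
      obtain ⟨i, _, hi⟩ := hbU
      exact hVB hi (hit i b hb)
    refine Set.Subset.antisymm hBM (closure_minimal ?_ hBc)
    rintro _ ⟨k, rfl⟩
    exact hit k x hxB

/-- If `X` is an infinite compact metric space, `f : X → X` is continuous, `X` is
`f`-minimal, and there exists a regularly recurrent point, then `S(f)` is
infinite. -/
theorem sset_infinite {X : Type*} [MetricSpace X] [CompactSpace X] [Infinite X]
    (f : X → X) (hf : Continuous f) (hmin : IsMinimalSet f Set.univ)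
    (hrr : ∃ x : X, RegularlyRecurrent f x) :
    (Sset f).Infinite := by
  classical
  obtain ⟨x, hx⟩ := hrr
  intro hfin
  obtain ⟨N, hN⟩ := hfin.bddAbove
  obtain ⟨y, hy⟩ := Infinite.exists_notMem_finset ((Finset.range (N + 1)).image fun i => f^[i] x)
  have hW : (⋂ i ∈ Set.Iic N, (f^[i]) ⁻¹' {y}ᶜ) ∈ nhds x := by
    refine (Filter.biInter_mem (Set.finite_Iic N)).2 fun i hi => ?_
    refine (isOpen_compl_singleton.preimage (hf.iterate i)).mem_nhds ?_
    intro h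
    exact hy (Finset.mem_image.2 ⟨i, Finset.mem_range.2 (Nat.lt_succ_of_le hi), h⟩)
  obtain ⟨V, hV, hVc, hVW⟩ := exists_mem_nhds_isClosed_subset hW
  obtain ⟨n, hn, hnV⟩ := hx V hV
  have hrn : RegularlyRecurrent (f^[n]) x := by
    intro U hU
    obtain ⟨m, hm, hmU⟩ := hx U hU
    refine ⟨m, hm, fun k => ?_⟩
    rw [← Function.iterate_mul, show n * (m * k) = m * (n * k) by ring]
    exact hmU _
  have hM := rr_orbit_minimal _ (hf.iterate n) x hrn
  set M := closure (Set.range fun k : ℕ => (f^[n])^[k] x) with hMdef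
  have hMV : M ⊆ V := by
    refine closure_minimal ?_ hVc
    rintro _ ⟨k, rfl⟩
    simp only [← Function.iterate_mul]
    exact hnV k
  have hex : ∃ t, 0 < t ∧ IsMinimalSet (f^[t]) M := ⟨n, hn, hM⟩
  obtain ⟨ht0, htM⟩ := Nat.find_spec hex
  set t := Nat.find hex with ht
  have htN : t ≤ N := hN ⟨ht0, M, htM, fun s hs hst h => Nat.find_min hex hst ⟨hs, h⟩⟩
  have huniv : (⋃ i ∈ Set.Iio t, f^[i] '' M) = Set.univ := by
    refine hmin.2.2.2 _ (Set.subset_univ _) ?_ ?_ ?_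
    · obtain ⟨z, hz⟩ := htM.1
      exact ⟨z, Set.mem_biUnion (show 0 ∈ Set.Iio t from ht0) ⟨z, hz, rfl⟩⟩
    · exact (Set.finite_Iio t).isClosed_biUnion fun i _ =>
        (htM.2.1.isCompact.image (hf.iterate i)).isClosed
    · rintro _ ⟨w, hw, rfl⟩
      simp only [Set.mem_iUnion, Set.mem_Iio] at hw ⊢
      obtain ⟨i, hi, z, hz, rfl⟩ := hw
      by_cases h : i + 1 < t
      · exact ⟨i + 1, h, z, hz, Function.iterate_succ_apply' f i z⟩
      · have : i + 1 = t := by omega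
        refine ⟨0, ht0, f^[t] z, htM.2.2.1 ⟨z, hz, rfl⟩, ?_⟩
        rw [← this]
        exact Function.iterate_succ_apply' f i z
  have hyu : y ∈ ⋃ i ∈ Set.Iio t, f^[i] '' M := huniv ▸ Set.mem_univ y
  simp only [Set.mem_iUnion, Set.mem_Iio] at hyu
  obtain ⟨i, hi, z, hz, hzy⟩ := hyu
  have := hVW (hMV hz)
  simp only [Set.mem_iInter] at this
  exact this i (show i ≤ N by omega) hzy
end

section
/- Let X be a compact metric space, f : X → X continuous, and suppose X itself is f-minimal. If k ∈ S(f) and n is a positive integer dividing k, then n ∈ S(f). -/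
theorem aux_img {X : Type*} (f : X → X) (i : ℕ) (A : Set X) :
    (Set.image f)^[i] A = f^[i] '' A := by
  rw [Set.image_iterate_eq]

theorem aux_inv {X : Type*} (f : X → X) (B : Set X) (n j : ℕ) (h : f^[n] '' B ⊆ B) :
    f^[n * j] '' B ⊆ B := by
  rw [Function.iterate_mul]
  exact Set.mapsTo_iff_image_subset.1 ((Set.mapsTo_iff_image_subset.2 h).iterate j)

theorem aux_min {X : Type*} [MetricSpace X] [CompactSpace X]
    (f : X → X) (hf : Continuous f) (k i : ℕ) (M : Set X) (hM : IsMinimalSet (f^[k]) M) :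
    IsMinimalSet (f^[k]) (f^[i] '' M) := by
  obtain ⟨h1, h2, h3, h4⟩ := hM
  refine ⟨h1.image _, (h2.isCompact.image (hf.iterate i)).isClosed, ?_, ?_⟩
  · rintro _ ⟨_, ⟨x, hx, rfl⟩, rfl⟩
    refine ⟨f^[k] x, h3 ⟨x, hx, rfl⟩, ?_⟩
    rw [← Function.iterate_add_apply, ← Function.iterate_add_apply, add_comm]
  · intro B hB hne hcl hinv
    refine hB.antisymm ?_
    have := h4 (M ∩ f^[i] ⁻¹' B) Set.inter_subset_left ?_
      (h2.inter (hcl.preimage (hf.iterate i))) ?_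
    · rintro _ ⟨x, hx, rfl⟩
      rw [← this] at hx
      exact hx.2
    · obtain ⟨y, hy⟩ := hne
      obtain ⟨x, hx, rfl⟩ := hB hy
      exact ⟨x, hx, hy⟩
    · rintro _ ⟨x, hx, rfl⟩
      refine ⟨h3 ⟨x, hx.1, rfl⟩, ?_⟩
      have := hinv ⟨_, hx.2, rfl⟩
      rw [← Function.iterate_add_apply, add_comm, Function.iterate_add_apply] at this
      exact this

theorem dvd_mem_sset {X : Type*} [MetricSpace X] [CompactSpace X]
    (f : X → X) (hf : Continuous f) (hmin : IsMinimalSet f Set.univ)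
    (k n : ℕ) (hk : k ∈ Sset f) (hn : 0 < n) (hdvd : n ∣ k) :
    n ∈ Sset f := by
  obtain ⟨hk0, M, hM, hno⟩ := hk
  obtain ⟨m, rfl⟩ := hdvd
  have hm : 0 < m := Nat.pos_of_mul_pos_left hk0
  have hmi := fun i => aux_min f hf (n * m) i M hM
  have hper : Function.IsPeriodicPt (Set.image f) (n * m) M := by
    change (Set.image f)^[n * m] M = M
    rw [aux_img]
    exact hM.2.2.2 _ hM.2.2.1 (hM.1.image _) (hmi _).2.1 (Set.image_mono hM.2.2.1)
  have hdiv : ∀ s, Function.IsPeriodicPt (Set.image f) s M → n * m ∣ s := by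
    intro s hs
    have hg := hs.gcd hper
    have hd : s.gcd (n * m) ∣ n * m := Nat.gcd_dvd_right _ _
    have hpos : 0 < s.gcd (n * m) := Nat.gcd_pos_of_pos_right _ hk0
    rcases (Nat.le_of_dvd hk0 hd).lt_or_eq with h | h
    · exfalso
      refine hno _ hpos h ⟨hM.1, hM.2.1, ?_, ?_⟩
      · rw [← aux_img]; exact hg.eq.subset
      · intro B hB hne hcl hinv
        refine hM.2.2.2 B hB hne hcl ?_
        obtain ⟨c, hc⟩ := hd
        have := aux_inv f B _ c hinv
        rwa [← hc] at this
    · rw [← h]; exact Nat.gcd_dvd_left _ _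
  have hadd : ∀ i j, f^[i + n * m * j] '' M = f^[i] '' M := by
    intro i j
    rw [← aux_img, Function.iterate_add_apply, (hper.mul_const j).eq, aux_img]
  have hinvN : f^[n] '' (⋃ j ∈ Finset.range m, f^[n * j] '' M) ⊆
      ⋃ j ∈ Finset.range m, f^[n * j] '' M := by
    rintro _ ⟨y, hy, rfl⟩
    simp only [Set.mem_iUnion, Finset.mem_range, exists_prop] at hy ⊢
    obtain ⟨j, hj, x, hx, rfl⟩ := hy
    have hx' : f^[n] (f^[n * j] x) ∈ f^[n * (j + 1)] '' M :=
      ⟨x, hx, by rw [← Function.iterate_add_apply]; congr 2; ring⟩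
    rcases (Nat.succ_le_of_lt hj).lt_or_eq with h | h
    · exact ⟨j + 1, h, hx'⟩
    · refine ⟨0, hm, ?_⟩
      have := hadd 0 1
      rw [← h] at this
      simp only [Nat.succ_eq_add_one, zero_add, mul_one] at this
      rw [this] at hx'
      simpa using hx'
  refine ⟨hn, ⋃ j ∈ Finset.range m, f^[n * j] '' M, ⟨?_, ?_, hinvN, ?_⟩, ?_⟩
  · obtain ⟨x, hx⟩ := hM.1
    exact ⟨x, by simp only [Set.mem_iUnion, Finset.mem_range, exists_prop]; exact ⟨0, hm, x, hx, rfl⟩⟩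
  · exact isClosed_biUnion_finset fun j _ => (hmi _).2.1
  · intro B hB hne hcl hinv
    refine hB.antisymm ?_
    obtain ⟨y, hy⟩ := hne
    have hy' := hB hy
    simp only [Set.mem_iUnion, Finset.mem_range, exists_prop] at hy'
    obtain ⟨j, hj, hyj⟩ := hy'
    have hsub : f^[n * j] '' M ⊆ B := by
      have := (hmi (n * j)).2.2.2 (B ∩ f^[n * j] '' M) Set.inter_subset_right ⟨y, hy, hyj⟩
        (hcl.inter (hmi _).2.1) ?_
      · rw [← this]; exact Set.inter_subset_left
      · rintro _ ⟨x, hx, rfl⟩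
        exact ⟨aux_inv f B n m hinv ⟨x, hx.1, rfl⟩, (hmi _).2.2.1 ⟨x, hx.2, rfl⟩⟩
    refine Set.iUnion₂_subset fun i _ => ?_
    rw [← hadd (n * i) j]
    obtain ⟨e, he⟩ : ∃ e, i + m * j = e + j :=
      ⟨i + m * j - j, by have := Nat.le_mul_of_pos_left j hm; omega⟩
    have : n * i + n * m * j = n * e + n * j := by
      rw [← mul_add, ← he]; ring
    rw [this, Function.iterate_add, Set.image_comp]
    exact (Set.image_mono hsub).trans (aux_inv f B n e hinv)
  · intro t ht htn hT
    obtain ⟨x, hx⟩ := hM.1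
    have hy := hT.2.2.1 ⟨x, by
      simp only [Set.mem_iUnion, Finset.mem_range, exists_prop]; exact ⟨0, hm, x, hx, rfl⟩, rfl⟩
    simp only [Set.mem_iUnion, Finset.mem_range, exists_prop] at hy
    obtain ⟨j, hj, hyj⟩ := hy
    have hyt : f^[t] x ∈ f^[t] '' M := ⟨x, hx, rfl⟩
    have hI : ∀ z ∈ f^[t] '' M ∩ f^[n * j] '' M,
        f^[n * m] z ∈ f^[t] '' M ∩ f^[n * j] '' M := fun z hz =>
      ⟨(hmi t).2.2.1 ⟨z, hz.1, rfl⟩, (hmi _).2.2.1 ⟨z, hz.2, rfl⟩⟩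
    have hI' := Set.image_subset_iff.2 hI
    have hc := (hmi t).2.1.inter (hmi (n * j)).2.1
    have e1 := (hmi t).2.2.2 _ Set.inter_subset_left ⟨_, hyt, hyj⟩ hc hI'
    have e2 := (hmi (n * j)).2.2.2 _ Set.inter_subset_right ⟨_, hyt, hyj⟩ hc hI'
    have e : f^[t] '' M = f^[n * j] '' M := e1.symm.trans e2
    obtain ⟨c, hc⟩ : ∃ c, c + t = n * m * t :=
      ⟨n * m * t - t, by have := Nat.le_mul_of_pos_left t hk0; omega⟩
    have hp : Function.IsPeriodicPt (Set.image f) (c + n * j) M := by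
      change (Set.image f)^[c + n * j] M = M
      rw [Function.iterate_add_apply, aux_img f (n * j), ← e, ← aux_img f t,
        ← Function.iterate_add_apply, hc]
      exact (hper.mul_const t).eq
    have h1 : n ∣ c + n * j := (Dvd.intro _ rfl).trans (hdiv _ hp)
    have h2 : n ∣ c := (Nat.dvd_add_left (Dvd.intro _ rfl)).1 h1
    have h3 : n ∣ c + t := hc ▸ (Dvd.intro _ (mul_assoc n m t).symm)
    have h4 : n ∣ t := (Nat.dvd_add_right h2).1 h3
    exact absurd (Nat.le_of_dvd ht h4) (by omega)
end

section
/- Let X be a compact metric space, f : X → X continuous, and suppose X itself is f-minimal. If k, n ∈ S(f) are coprime, then k·n ∈ S(f). -/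
theorem aux_period {X : Type*} [TopologicalSpace X] (f : X → X) (hf : Continuous f)
    (k : ℕ) (hk : 0 < k) (M : Set X) (hM : IsMinimalSet (f^[k]) M)
    (hlt : ∀ t : ℕ, 0 < t → t < k → ¬ IsMinimalSet (f^[t]) M)
    (t : ℕ) (x : X) (hx : x ∈ M) (hxt : f^[t] x ∈ M) : k ∣ t := by
  obtain ⟨hne, hcl, hinv, hmin⟩ := hM
  have key : ∀ s : ℕ, ∀ y ∈ M, f^[s] y ∈ M → ∀ z ∈ M, f^[s] z ∈ M := by
    intro s y hy hys
    have h := hmin (M ∩ f^[s] ⁻¹' M) Set.inter_subset_left ⟨y, hy, hys⟩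
      (hcl.inter (hcl.preimage (hf.iterate s))) (by
        rintro _ ⟨z, ⟨hz, hzs⟩, rfl⟩
        refine ⟨hinv ⟨z, hz, rfl⟩, ?_⟩
        show f^[s] (f^[k] z) ∈ M
        rw [← Function.iterate_add_apply, add_comm, Function.iterate_add_apply]
        exact hinv ⟨_, hzs, rfl⟩)
    intro z hz
    rw [← h] at hz
    exact hz.2
  have mulmem : ∀ (s : ℕ) (B : Set X), (∀ z ∈ B, f^[s] z ∈ B) → ∀ q : ℕ, ∀ z ∈ B,
      f^[s * q] z ∈ B := by
    intro s B hs q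
    induction q with
    | zero => intro z hz; simpa using hz
    | succ q ih =>
      intro z hz
      rw [Nat.mul_succ, Function.iterate_add_apply]
      exact ih _ (hs z hz)
  have hex : ∃ d : ℕ, 0 < d ∧ ∀ z ∈ M, f^[d] z ∈ M := ⟨k, hk, fun z hz => hinv ⟨z, hz, rfl⟩⟩
  classical
  set d := Nat.find hex with hd
  obtain ⟨hd0, hdM⟩ := Nat.find_spec hex
  rw [← hd] at hd0 hdM
  have hdiv : ∀ s : ℕ, ∀ y ∈ M, f^[s] y ∈ M → d ∣ s := by
    intro s y hy hys
    by_contra hnd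
    have hr : 0 < s % d := Nat.pos_of_ne_zero (fun h => hnd (Nat.dvd_of_mod_eq_zero h))
    refine Nat.find_min hex (Nat.mod_lt s hd0) ⟨hr, ?_⟩
    refine key _ _ (mulmem d M hdM (s / d) y hy) ?_
    rw [← Function.iterate_add_apply, Nat.mod_add_div]
    exact hys
  have hdk : d ∣ k := hdiv k x hx (hinv ⟨x, hx, rfl⟩)
  have hdmin : IsMinimalSet (f^[d]) M := by
    refine ⟨hne, hcl, ?_, ?_⟩
    · rintro _ ⟨z, hz, rfl⟩; exact hdM z hz
    · intro B hB hBne hBc hBi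
      refine hmin B hB hBne hBc ?_
      rintro _ ⟨z, hz, rfl⟩
      obtain ⟨q, hq⟩ := hdk
      rw [hq]
      exact mulmem d B (fun z hz => hBi ⟨z, hz, rfl⟩) q z hz
  have hkd : k ≤ d := by
    by_contra h
    exact hlt d hd0 (not_le.mp h) hdmin
  have : d = k := le_antisymm (Nat.le_of_dvd hk hdk) hkd
  rw [← this]
  exact hdiv t x hx hxt

theorem aux_exists {X : Type*} [TopologicalSpace X] [CompactSpace X] (g : X → X)
    (P : Set X) (hne : P.Nonempty) (hcl : IsClosed P) (hinv : g '' P ⊆ P) :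
    ∃ Q ⊆ P, IsMinimalSet g Q := by
  obtain ⟨Q, hQP, hQ⟩ := zorn_superset_nonempty
    {B : Set X | B.Nonempty ∧ IsClosed B ∧ g '' B ⊆ B} (by
      intro c hc hch hcne
      refine ⟨⋂₀ c, ⟨?_, ?_, ?_⟩, fun s hs => Set.sInter_subset_of_mem hs⟩
      · have : Nonempty c := hcne.to_subtype
        have hdir : DirectedOn (· ⊇ ·) c := by
          intro a ha b hb
          rcases hch.total ha hb with h | h
          · exact ⟨a, ha, subset_rfl, h⟩
          · exact ⟨b, hb, h, subset_rfl⟩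
        refine IsCompact.nonempty_sInter_of_directed_nonempty_isCompact_isClosed
          hdir (fun U hU => (hc hU).1) (fun U hU => (hc hU).2.1.isCompact)
          (fun U hU => (hc hU).2.1)
      · exact isClosed_sInter (fun U hU => (hc hU).2.1)
      · rintro _ ⟨z, hz, rfl⟩ U hU
        exact (hc hU).2.2 ⟨z, hz U hU, rfl⟩) P ⟨hne, hcl, hinv⟩
  refine ⟨Q, hQP, hQ.prop.1, hQ.prop.2.1, hQ.prop.2.2, ?_⟩
  intro B hB h1 h2 h3
  exact hB.antisymm (hQ.le_of_le ⟨h1, h2, h3⟩ hB)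

theorem aux_mul {X : Type*} (f : X → X) (s : ℕ) (B : Set X) (hs : f^[s] '' B ⊆ B) (q : ℕ) :
    ∀ z ∈ B, f^[s * q] z ∈ B := by
  induction q with
  | zero => intro z hz; simpa using hz
  | succ q ih =>
    intro z hz
    rw [Nat.mul_succ, Function.iterate_add_apply]
    exact ih _ (hs ⟨z, hz, rfl⟩)

/-- If `X` is a compact metric space, `f` continuous, `X` is `f`-minimal, and
`k, n ∈ S(f)` are coprime, then `k * n ∈ S(f)`. -/
theorem coprime_mul_mem_sset {X : Type*} [MetricSpace X] [CompactSpace X]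
    (f : X → X) (hf : Continuous f) (hmin : IsMinimalSet f Set.univ)
    (k n : ℕ) (hk : k ∈ Sset f) (hn : n ∈ Sset f) (hcop : Nat.Coprime k n) :
    k * n ∈ Sset f := by
  obtain ⟨hk0, M, hM, hMlt⟩ := hk
  obtain ⟨hn0, N, hN, hNlt⟩ := hn
  refine ⟨Nat.mul_pos hk0 hn0, ?_⟩
  have hcov : (⋃ j ∈ Set.Iio n, f^[j] '' N) = Set.univ := by
    refine hmin.2.2.2 _ (Set.subset_univ _) ?_ ?_ ?_
    · obtain ⟨y, hy⟩ := hN.1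
      exact ⟨y, Set.mem_biUnion (show 0 ∈ Set.Iio n from hn0) ⟨y, hy, rfl⟩⟩
    · exact (Set.finite_Iio n).isClosed_biUnion
        (fun j _ => (hN.2.1.isCompact.image (hf.iterate j)).isClosed)
    · rintro _ ⟨z, hz, rfl⟩
      obtain ⟨j, hj, y, hy, rfl⟩ := Set.mem_iUnion₂.mp hz
      have hj' : j < n := hj
      rw [← Function.iterate_succ_apply' f]
      by_cases h : j + 1 < n
      · exact Set.mem_biUnion (show j + 1 ∈ Set.Iio n from h) ⟨y, hy, rfl⟩
      · have : j + 1 = n := by omega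
        refine Set.mem_biUnion (show 0 ∈ Set.Iio n from hn0) ⟨f^[j+1] y, ?_, rfl⟩
        rw [this]
        exact hN.2.2.1 ⟨y, hy, rfl⟩
  obtain ⟨x, hx⟩ := hM.1
  have hxc : x ∈ ⋃ j ∈ Set.Iio n, f^[j] '' N := hcov ▸ Set.mem_univ x
  obtain ⟨j, hj, y, hy, hyx⟩ := Set.mem_iUnion₂.mp hxc
  have hj' : j < n := hj
  obtain ⟨Q, hQP, hQ⟩ := aux_exists (f^[k * n]) (M ∩ f^[j] '' N) ⟨x, hx, y, hy, hyx⟩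
    (hM.2.1.inter (hN.2.1.isCompact.image (hf.iterate j)).isClosed) (by
      rintro _ ⟨_, ⟨hz, w, hw, rfl⟩, rfl⟩
      refine ⟨aux_mul f k M hM.2.2.1 n _ hz, f^[n * k] w, aux_mul f n N hN.2.2.1 k _ hw, ?_⟩
      rw [← Function.iterate_add_apply, ← Function.iterate_add_apply]
      congr 1
      rw [mul_comm, add_comm])
  refine ⟨Q, hQ, ?_⟩
  intro t ht0 htlt hQt
  obtain ⟨q, hq⟩ := hQ.1
  have hqt : f^[t] q ∈ Q := hQt.2.2.1 ⟨q, hq, rfl⟩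
  have h1 : k ∣ t := aux_period f hf k hk0 M hM hMlt t q (hQP hq).1 (hQP hqt).1
  have h2 : n ∣ t := by
    obtain ⟨w, hw, hwq⟩ := (hQP hq).2
    obtain ⟨w', hw', hwq'⟩ := (hQP hqt).2
    refine aux_period f hf n hn0 N hN hNlt t (f^[n] w) (hN.2.2.1 ⟨w, hw, rfl⟩) ?_
    have e : f^[t] (f^[n] w) = f^[n] w' := by
      have e1 : n = (n - j) + j := by omega
      rw [e1, Function.iterate_add_apply f (n - j) j w,
        Function.iterate_add_apply f (n - j) j w', hwq, hwq',
        ← Function.iterate_add_apply, ← Function.iterate_add_apply, add_comm]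
    rw [e]
    exact hN.2.2.1 ⟨w', hw', rfl⟩
  exact absurd (Nat.le_of_dvd ht0 (hcop.mul_dvd_of_dvd_of_dvd h1 h2)) (not_le.mpr htlt)
end

section
/- Let Z, S be nonempty finite types, τ : S → Z a surjection, and σ_τ the zip shift on the zip space Σ. Let X ⊆ Σ be a closed subset with σ_τ '' X = X. Let j ≥ 2, let τ' : Fin j → Fin 2 be a surjection, and let (Δ, f_α) be the corresponding bilateral adding machine. Then there is no homeomorphism h : X → Δ (X with the subspace topology) satisfying h(σ_τ(x)) = f_α(h(x)) for all x ∈ X; that is, the restriction of the zip shift to X is never topologically conjugate to the bilateral adding machine map. -/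
def AgreeUpTo (j N : ℕ) (x y : AddingMachineSpace j) : Prop :=
  ∀ n, n < N + 1 → x.1 n = y.1 n ∧ x.2 n = y.2 n

lemma carryPos_congr (j : ℕ) (v w : ℕ → ZMod j) (n : ℕ) (h : ∀ m, m < n → v m = w m) :
    carryPos j v n = carryPos j w n := by
  induction n with
  | zero => rfl
  | succ n ih =>
    simp only [carryPos]
    rw [ih (fun m hm => h m (by omega)), h n (by omega)]

lemma carryNeg_congr (j : ℕ) (τ : ZMod j → ZMod 2) (u u' : ℕ → ZMod 2) (v w : ℕ → ZMod j)
    (h0 : v 0 = w 0) (n : ℕ) (h : ∀ m, m < n → u m = u' m) :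
    carryNeg j τ u v n = carryNeg j τ u' w n := by
  induction n with
  | zero => simp only [carryNeg, h0]
  | succ n ih =>
    simp only [carryNeg]
    rw [ih (fun m hm => h m (by omega)), h n (by omega)]

lemma AgreeUpTo.map {j N : ℕ} (τ : ZMod j → ZMod 2) {x y : AddingMachineSpace j}
    (h : AgreeUpTo j N x y) : AgreeUpTo j N (addingMachine j τ x) (addingMachine j τ y) := by
  intro n hn
  simp only [addingMachine]
  rw [carryPos_congr j x.2 y.2 n (fun m hm => (h m (by omega)).2),
    carryNeg_congr j τ x.1 y.1 x.2 y.2 (h 0 (by omega)).2 n (fun m hm => (h m (by omega)).1),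
    (h n hn).1, (h n hn).2]
  exact ⟨rfl, rfl⟩

lemma AgreeUpTo.of_map {j N : ℕ} (τ : ZMod j → ZMod 2) {x y : AddingMachineSpace j}
    (h : AgreeUpTo j N (addingMachine j τ x) (addingMachine j τ y)) : AgreeUpTo j N x y := by
  have h2 : ∀ n, n < N + 1 → x.2 n = y.2 n := by
    intro n
    induction n using Nat.strong_induction_on with
    | _ n ih =>
      intro hn
      have := (h n hn).2
      simp only [addingMachine] at this
      rw [carryPos_congr j x.2 y.2 n (fun m hm => ih m hm (by omega))] at this
      exact add_right_cancel this
  have h1 : ∀ n, n < N + 1 → x.1 n = y.1 n := by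
    intro n
    induction n using Nat.strong_induction_on with
    | _ n ih =>
      intro hn
      have := (h n hn).1
      simp only [addingMachine] at this
      rw [carryNeg_congr j τ x.1 y.1 x.2 y.2 (h2 0 (by omega)) n
        (fun m hm => ih m hm (by omega))] at this
      exact add_right_cancel this
  exact fun n hn => ⟨h1 n hn, h2 n hn⟩

lemma exists_agree_determines {S : Type*} [TopologicalSpace S] [DiscreteTopology S]
    (j : ℕ) [NeZero j] (φ : AddingMachineSpace j → S) (hφ : Continuous φ) :
    ∃ N, ∀ x y, AgreeUpTo j N x y → φ x = φ y := by
  by_contra! hcon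
  let K : ℕ → Set (AddingMachineSpace j × AddingMachineSpace j) :=
    fun N => {p | AgreeUpTo j N p.1 p.2 ∧ φ p.1 ≠ φ p.2}
  have hclosed : ∀ N, IsClosed (K N) := by
    intro N
    have e1 : IsClosed {p : AddingMachineSpace j × AddingMachineSpace j |
        AgreeUpTo j N p.1 p.2} := by
      simp only [AgreeUpTo, Set.setOf_forall]
      refine isClosed_iInter fun n => isClosed_iInter fun _ => ?_
      exact (isClosed_eq (by fun_prop) (by fun_prop)).inter
        (isClosed_eq (by fun_prop) (by fun_prop))
    have e2 : IsClosed {p : AddingMachineSpace j × AddingMachineSpace j | φ p.1 ≠ φ p.2} :=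
      (isClosed_discrete {q : S × S | q.1 ≠ q.2}).preimage
        ((hφ.comp continuous_fst).prodMk (hφ.comp continuous_snd))
    exact e1.inter e2
  obtain ⟨p, hp⟩ := IsCompact.nonempty_iInter_of_sequence_nonempty_isCompact_isClosed K
    (fun N p hp => ⟨fun n hn => hp.1 n (by omega), hp.2⟩)
    (fun N => by
      obtain ⟨x, y, h1, h2⟩ := hcon N
      exact ⟨(x, y), h1, h2⟩)
    (hclosed 0).isCompact hclosed
  rw [Set.mem_iInter] at hp
  apply (hp 0).2
  congr 1
  exact Prod.ext (funext fun n => ((hp n).1 n (by omega)).1)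
    (funext fun n => ((hp n).1 n (by omega)).2)

/-- No restriction of a zip shift to a closed invariant subset is topologically
conjugate to a bilateral adding machine: if `X ⊆ Σ` is closed with
`σ_τ '' X = X`, there is no homeomorphism `h : X → Δ` with
`h ∘ σ_τ = f_α ∘ h` on `X`. -/
theorem zipShift_restriction_not_conjugate_addingMachine
    {Z S : Type*} [Finite Z] [Finite S] [Nonempty Z] [Nonempty S]
    [TopologicalSpace Z] [DiscreteTopology Z] [TopologicalSpace S] [DiscreteTopology S]
    (τ : S → Z) (hτ : Function.Surjective τ)
    (X : Set (ZipSpace Z S)) (hXclosed : IsClosed X) (hXinv : zipShift τ '' X = X)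
    (j : ℕ) (hj : 2 ≤ j) (τ' : ZMod j → ZMod 2) (hτ' : Function.Surjective τ') :
    ¬ ∃ h : X ≃ₜ AddingMachineSpace j,
      ∀ (x : X) (hx : zipShift τ x.1 ∈ X),
        h ⟨zipShift τ x.1, hx⟩ = addingMachine j τ' (h x) := by
  rintro ⟨h, hh⟩
  have : NeZero j := ⟨by omega⟩
  have hmem : ∀ x ∈ X, zipShift τ x ∈ X := fun x hx => hXinv ▸ Set.mem_image_of_mem _ hx
  let k : AddingMachineSpace j → ZipSpace Z S := fun z => (h.symm z).1
  have hkc : Continuous k := continuous_subtype_val.comp h.symm.continuous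
  have hkinj : Function.Injective k := Subtype.val_injective.comp h.symm.injective
  have hk : ∀ z, k (addingMachine j τ' z) = zipShift τ (k z) := by
    intro z
    have := hh (h.symm z) (hmem _ (h.symm z).2)
    rw [h.apply_symm_apply] at this
    simp only [k]
    rw [← this, h.symm_apply_apply]
  have hsurj : ∀ z, ∃ w, addingMachine j τ' w = z := by
    intro z
    have hz : (h.symm z).1 ∈ zipShift τ '' X := by rw [hXinv]; exact (h.symm z).2
    obtain ⟨w, hw, hwz⟩ := hz
    refine ⟨h ⟨w, hw⟩, ?_⟩
    rw [← hh ⟨w, hw⟩ (hmem w hw)]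
    have : (⟨zipShift τ w, hmem w hw⟩ : X) = h.symm z := Subtype.ext hwz
    rw [this, h.apply_symm_apply]
  obtain ⟨N, hN⟩ := exists_agree_determines j (fun z => (k z).2 0) (by fun_prop)
  have hpos : ∀ n x y, AgreeUpTo j N x y → (k x).2 n = (k y).2 n := by
    intro n
    induction n with
    | zero => exact hN
    | succ n ih =>
      intro x y hxy
      have := ih _ _ (hxy.map τ')
      rw [hk, hk] at this
      exact this
  have hneg : ∀ n x y, AgreeUpTo j N x y → (k x).1 n = (k y).1 n := by
    intro n
    induction n with
    | zero =>
      intro x y hxy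
      obtain ⟨x, rfl⟩ := hsurj x
      obtain ⟨y, rfl⟩ := hsurj y
      rw [hk, hk]
      exact congrArg τ (hN _ _ hxy.of_map)
    | succ n ih =>
      intro x y hxy
      obtain ⟨x, rfl⟩ := hsurj x
      obtain ⟨y, rfl⟩ := hsurj y
      rw [hk, hk]
      exact ih _ _ hxy.of_map
  have hag : AgreeUpTo j N ((fun _ => 0, fun _ => 0) : AddingMachineSpace j)
      (fun n => if n = N + 1 then 1 else 0, fun _ => 0) := by
    intro n hn
    have : n ≠ N + 1 := by omega
    simp [this]
  have heq := hkinj (Prod.ext (funext fun n => hneg n _ _ hag) (funext fun n => hpos n _ _ hag))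
  have := congrFun (congrArg Prod.fst heq) (N + 1)
  simp at this
end
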